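/- Let n ≥ 5 be odd, 0 ≤ ε ≤ π/(2n), set n₊ = (n+1)/2, n₋ = (n−1)/2, ν = (−1)^{n₋}. Let |ψ₋⟩ = (|0⟩^{⊗n₋} + e^{−νi(3n+ν)π/(4n)}|1⟩^{⊗n₋})/√2, |ψ₊⟩ = (|0⟩^{⊗n₊} + e^{νi(3n+ν)π/(4n)}|1⟩^{⊗n₊})/√2, and |ψₙ⟩ = |ψ₋⟩ ⊗ |ψ₊⟩ ∈ ℂ^{2ⁿ} (the first n₋ tensor factors carrying |ψ₋⟩). For k = 1,…,n and j = 1,…,n define g_k^{(j)} = ν·(−1)^k·sign((k − n₊)·(j − n/2)) and N_k^{(j)} = cos(kπ/n + g_k^{(j)}ε)·σx + sin(kπ/n + g_k^{(j)}ε)·σy, and let 𝒲ᵉ = (1/2)·[ 𝟙^{⊗n} − Σ_{ℓ=±1} ((𝟙 + ℓ·σz)/2)^{⊗n} − (1/n)·Σ_{k=1}^{n} (−1)^k·(N_k^{(1)} ⊗ ⋯ ⊗ N_k^{(n)}) ]. Then ⟨ψₙ| 𝒲ᵉ |ψₙ⟩ = (1/(4n))·[ n − 2 − (n−1)·cos ε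 + cos(nε) − sin(nε)/tan(π/(2n)) ]. -/

import Mathlib

open Matrix Real

noncomputable def σx : Matrix (Fin 2) (Fin 2) ℂ := !![0, 1; 1, 0]
noncomputable def σy : Matrix (Fin 2) (Fin 2) ℂ := !![0, -Complex.I; Complex.I, 0]
noncomputable def σz : Matrix (Fin 2) (Fin 2) ℂ := !![1, 0; 0, -1]

/-- n-fold Kronecker power A^{⊗n} of a 2×2 matrix, on the index set Fin n → Fin 2. -/
noncomputable def kronPow (n : ℕ) (A : Matrix (Fin 2) (Fin 2) ℂ) :
    Matrix (Fin n → Fin 2) (Fin n → Fin 2) ℂ :=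
  Matrix.of fun i j => ∏ t, A (i t) (j t)

/-- Kronecker product A₁ ⊗ A₂ ⊗ ⋯ ⊗ Aₙ of a family of 2×2 matrices. -/
noncomputable def kronFam (n : ℕ) (A : Fin n → Matrix (Fin 2) (Fin 2) ℂ) :
    Matrix (Fin n → Fin 2) (Fin n → Fin 2) ℂ :=
  Matrix.of fun i j => ∏ t, A t (i t) (j t)

theorem star_dotProduct_mulVec_sum_single {ι κ : Type*} [Fintype ι] [DecidableEq ι] [Fintype κ]
    (A : Matrix ι ι ℂ) (c : κ → ℂ) (v : κ → ι) :
    star (∑ p, c p • Pi.single (v p) (1 : ℂ)) ⬝ᵥ A *ᵥ (∑ p, c p • Pi.single (v p) (1 : ℂ))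
      = ∑ p, ∑ q, star (c p) * A (v p) (v q) * c q := by
  rw [star_sum, sum_dotProduct]
  refine Finset.sum_congr rfl fun p _ => ?_
  rw [Matrix.mulVec_sum, dotProduct_sum]
  refine Finset.sum_congr rfl fun q _ => ?_
  rw [Matrix.mulVec_smul, Matrix.mulVec_single_one, star_smul, ← Pi.single_star]
  simp [mul_comm]

theorem prod_indicator_mul_prod_indicator {n : ℕ} (S : Fin n → Prop) [DecidablePred S]
    (a b : Fin 2) (i : Fin n → Fin 2) :
    (∏ t with S t, if i t = a then (1 : ℂ) else 0) * (∏ t with ¬ S t, if i t = b then (1 : ℂ) else 0)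
      = (Pi.single (fun t => if S t then a else b) (1 : ℂ) : (Fin n → Fin 2) → ℂ) i := by
  rw [Finset.prod_ite_zero, Finset.prod_ite_zero, Pi.single_apply]
  simp only [Finset.prod_const_one, ← ite_and, Finset.mem_filter, Finset.mem_univ, true_and,
    ite_mul, one_mul, zero_mul]
  congr 1
  rw [funext_iff, eq_iff_iff]
  refine ⟨fun h t => ?_, fun h => ⟨fun t ht => ?_, fun t ht => ?_⟩⟩
  · by_cases ht : S t <;> simp [ht, h.1, h.2]
  all_goals simpa [ht] using h t

/-- The expectation value of a product operator in a biseparable state factorizes. -/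
theorem star_dotProduct_kronFam_mulVec {n : ℕ} (S : Fin n → Prop) [DecidablePred S]
    (A : Fin n → Matrix (Fin 2) (Fin 2) ℂ) (c d : Fin 2 → ℂ) (ψ : (Fin n → Fin 2) → ℂ)
    (hψ : ∀ i, ψ i = (∑ a, c a * ∏ t with S t, if i t = a then 1 else 0) *
      (∑ b, d b * ∏ t with ¬ S t, if i t = b then 1 else 0)) :
    star ψ ⬝ᵥ (kronFam n A).mulVec ψ
      = (∑ a, ∑ a', star (c a) * (∏ t with S t, A t a a') * c a') *
        (∑ b, ∑ b', star (d b) * (∏ t with ¬ S t, A t b b') * d b') := by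
  have key : ψ = ∑ p : Fin 2 × Fin 2,
      (c p.1 * d p.2) • Pi.single (fun t => if S t then p.1 else p.2) (1 : ℂ) := by
    funext i
    rw [hψ, Finset.sum_mul_sum, Fintype.sum_prod_type, Finset.sum_apply]
    refine Finset.sum_congr rfl fun a _ => ?_
    rw [Finset.sum_apply]
    refine Finset.sum_congr rfl fun b _ => ?_
    rw [Pi.smul_apply, ← prod_indicator_mul_prod_indicator, smul_eq_mul]
    ring
  have entry (a b a' b' : Fin 2) :
      kronFam n A (fun t => if S t then a else b) (fun t => if S t then a' else b')
        = (∏ t with S t, A t a a') * ∏ t with ¬ S t, A t b b' := by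
    rw [kronFam, Matrix.of_apply, ← Finset.prod_filter_mul_prod_filter_not _ S]
    congr 1 <;> refine Finset.prod_congr rfl fun t ht => ?_ <;>
      simp [(Finset.mem_filter.1 ht).2]
  rw [key, star_dotProduct_mulVec_sum_single]
  simp only [Fintype.sum_prod_type, entry, Fin.sum_univ_two, star_mul']
  ring

theorem cos_smul_σx_add_sin_smul_σy (θ : ℝ) :
    cos θ • σx + sin θ • σy
      = !![0, Complex.exp (-(θ * Complex.I)); Complex.exp (θ * Complex.I), 0] := by
  ext a b
  fin_cases a <;> fin_cases b <;>
    simp [σx, σy, Complex.exp_mul_I, ← neg_mul, Complex.ofReal_cos, Complex.ofReal_sin]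

theorem half_phase_sum (r : ℕ) (θ φ : ℝ) (z : ℂ) (hz : z = Complex.exp (φ * Complex.I)) :
    (star z * Complex.exp (θ * Complex.I) ^ r + Complex.exp (-(θ * Complex.I)) ^ r * z) / 2
      = (cos (r * θ - φ) : ℂ) := by
  have : star z = Complex.exp (-(φ * Complex.I)) := by
    rw [hz, ← starRingEnd_apply, ← Complex.exp_conj]; simp
  rw [this, hz, ← Complex.exp_nat_mul, ← Complex.exp_nat_mul, ← Complex.exp_add, ← Complex.exp_add,
    Complex.ofReal_cos, Complex.cos]
  push_cast
  ring_nf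

theorem sum_sum_phase_qubit (θ : ℝ) (z : ℂ) (hz : z = Complex.exp (θ * Complex.I))
    (P : Fin 2 → Fin 2 → ℂ) :
    ∑ a, ∑ b, star ((Real.sqrt 2 : ℂ)⁻¹ * ![1, z] a) * P a b * ((Real.sqrt 2 : ℂ)⁻¹ * ![1, z] b)
      = (P 0 0 + P 1 1 + (star z * P 1 0 + P 0 1 * z)) / 2 := by
  have h2 : (Real.sqrt 2 : ℂ)⁻¹ * (Real.sqrt 2 : ℂ)⁻¹ = 1 / 2 := by
    rw [← mul_inv, ← Complex.ofReal_mul, Real.mul_self_sqrt (by norm_num)]; norm_num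
  have hstar : star (Real.sqrt 2 : ℂ)⁻¹ = (Real.sqrt 2 : ℂ)⁻¹ := by
    rw [← starRingEnd_apply, map_inv₀, Complex.conj_ofReal]
  have hzz : star z * z = 1 := by
    rw [hz, ← starRingEnd_apply, ← Complex.exp_conj, ← Complex.exp_add]; simp
  simp only [Fin.sum_univ_two, Matrix.cons_val_zero, Matrix.cons_val_one, star_mul', hstar,
    star_one]
  linear_combination (P 0 0 + P 1 1 * (star z * z) + (star z * P 1 0 + P 0 1 * z)) * h2
    + P 1 1 / 2 * hzz

theorem sum_neg_one_pow_mul_sin_odd (n : ℕ) (x : ℝ) :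
    2 * cos x * ∑ k ∈ Finset.Icc 1 n, (-1 : ℝ) ^ k * sin ((2 * k - 1) * x)
      = (-1) ^ n * sin (2 * n * x) := by
  induction n with
  | zero => simp
  | succ n ih =>
    rw [Finset.sum_Icc_succ_top (by omega), mul_add, ih]
    have h1 : sin (2 * ((n + 1 : ℕ) : ℝ) * x) = sin ((2 * n + 1) * x) * cos x + cos ((2 * n + 1) * x) * sin x := by
      rw [← sin_add]; push_cast; ring_nf
    have h2 : sin (2 * (n : ℝ) * x) = sin ((2 * n + 1) * x) * cos x - cos ((2 * n + 1) * x) * sin x := by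
      rw [← sin_sub]; ring_nf
    have h3 : (2 * ((n + 1 : ℕ) : ℝ) - 1) * x = (2 * n + 1) * x := by push_cast; ring
    rw [h1, h2, h3]; ring

theorem two_mul_sin_mul_sum_cos_odd (m : ℕ) (x : ℝ) :
    2 * sin x * ∑ k ∈ Finset.Icc 1 m, cos ((2 * k - 1) * x) = sin (2 * m * x) := by
  induction m with
  | zero => simp
  | succ n ih =>
    rw [Finset.sum_Icc_succ_top (by omega), mul_add, ih]
    have h1 : sin (2 * ((n + 1 : ℕ) : ℝ) * x) = sin ((2 * n + 1) * x) * cos x + cos ((2 * n + 1) * x) * sin x := by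
      rw [← sin_add]; push_cast; ring_nf
    have h2 : sin (2 * (n : ℝ) * x) = sin ((2 * n + 1) * x) * cos x - cos ((2 * n + 1) * x) * sin x := by
      rw [← sin_sub]; ring_nf
    have h3 : (2 * ((n + 1 : ℕ) : ℝ) - 1) * x = (2 * n + 1) * x := by push_cast; ring
    rw [h1, h2, h3]; ring

theorem sum_Icc_one_odd {M : Type*} [AddCommMonoid M] (m : ℕ) (f : ℕ → M) :
    ∑ k ∈ Finset.Icc 1 (2 * m + 1), f k
      = ∑ k ∈ Finset.Icc 1 m, (f k + f (2 * m + 2 - k)) + f (m + 1) := by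
  have hsplit : Finset.Icc 1 (2 * m + 1)
      = (Finset.Icc 1 m ∪ Finset.Icc (m + 2) (2 * m + 1)) ∪ {m + 1} := by
    ext k; simp only [Finset.mem_union, Finset.mem_Icc, Finset.mem_singleton]; omega
  rw [hsplit, Finset.sum_union, Finset.sum_union, Finset.sum_singleton, Finset.sum_add_distrib]
  · congr 2
    refine Finset.sum_nbij' (fun k => 2 * m + 2 - k) (fun k => 2 * m + 2 - k) ?_ ?_ ?_ ?_ ?_ <;>
      intro k hk <;> simp only [Finset.mem_Icc] at hk ⊢
    any_goals omega
    congr 1; omega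
  · rw [Finset.disjoint_left]; intro k; simp only [Finset.mem_Icc]; omega
  · rw [Finset.disjoint_left]; intro k
    simp only [Finset.mem_union, Finset.mem_Icc, Finset.mem_singleton]; omega

theorem sum_sign_mul_cos_odd (m : ℕ) (s : ℕ → ℝ) (x : ℝ) (hx : (2 * m + 1) * x = π / 2)
    (hx' : sin x ≠ 0)
    (h_lt : ∀ k, k ≤ m → s k = -1) (h_eq : s (m + 1) = 0) (h_gt : ∀ k, m + 2 ≤ k → s k = 1) :
    ∑ k ∈ Finset.Icc 1 (2 * m + 1), s k * cos ((2 * k - 1) * x) = -(1 / tan x) := by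
  have hsum := two_mul_sin_mul_sum_cos_odd m x
  have hc : sin (2 * m * x) = cos x := by
    rw [← sin_pi_div_two_sub, ← hx]; ring_nf
  rw [sum_Icc_one_odd, h_eq, zero_mul, add_zero, tan_eq_sin_div_cos, one_div_div,
    Finset.sum_congr rfl (g := fun k : ℕ => -2 * cos ((2 * k - 1) * x)), ← Finset.mul_sum]
  · rw [← hc, ← hsum, mul_right_comm, mul_div_cancel_right₀ _ hx']; ring
  · intro k hk
    rw [Finset.mem_Icc] at hk
    have hk2 : ((2 * m + 2 - k : ℕ) : ℝ) = 2 * m + 2 - k := by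
      rw [Nat.cast_sub (by omega)]; push_cast; ring
    have : (2 * ((2 * m + 2 - k : ℕ) : ℝ) - 1) * x = π - (2 * k - 1) * x := by
      rw [hk2]; linear_combination 2 * hx
    rw [this, cos_pi_sub, h_lt k hk.2, h_gt _ (by omega)]; ring

theorem sum_witness_terms (m : ℕ) (hm : 0 < m) (s : ℕ → ℝ) (x ε : ℝ)
    (hx : (2 * m + 1) * x = π / 2)
    (h_lt : ∀ k, k ≤ m → s k = -1) (h_eq : s (m + 1) = 0) (h_gt : ∀ k, m + 2 ≤ k → s k = 1) :
    ∑ k ∈ Finset.Icc 1 (2 * m + 1), (cos (s k * ε)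
        - (-1) ^ m * (-1) ^ k * sin ((2 * k - 1) * x) * cos ((2 * m + 1) * (s k * ε))
        - cos ((2 * k - 1) * x) * sin ((2 * m + 1) * (s k * ε)))
      = 2 * m * cos ε + 2 - cos ((2 * m + 1) * ε) + sin ((2 * m + 1) * ε) / tan x := by
  have hm' : (1 : ℝ) ≤ m := by exact_mod_cast hm
  have hx0 : 0 < x := by
    by_contra! h
    have := mul_nonpos_of_nonneg_of_nonpos (by positivity : (0 : ℝ) ≤ 2 * m + 1) h
    linarith [pi_pos]
  have hx1 : x < π / 2 := by nlinarith
  have hs : sin x ≠ 0 := (sin_pos_of_pos_of_lt_pi hx0 (by linarith [pi_pos])).ne'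
  have hc : cos x ≠ 0 := (cos_pos_of_mem_Ioo ⟨by linarith, hx1⟩).ne'
  have hsin : ∑ k ∈ Finset.Icc 1 (2 * m + 1), (-1 : ℝ) ^ k * sin ((2 * k - 1) * x) = 0 := by
    have h := sum_neg_one_pow_mul_sin_odd (2 * m + 1) x
    have h2 : sin (2 * ((2 * m + 1 : ℕ) : ℝ) * x) = 0 := by
      rw [show 2 * ((2 * m + 1 : ℕ) : ℝ) * x = π by push_cast; linear_combination 2 * hx, sin_pi]
    rw [h2, mul_zero] at h
    simpa [hc] using h
  have hcos := sum_sign_mul_cos_odd m s x hx hs h_lt h_eq h_gt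
  have hterm : ∀ k ∈ Finset.Icc 1 (2 * m + 1), (cos (s k * ε)
        - (-1) ^ m * (-1) ^ k * sin ((2 * k - 1) * x) * cos ((2 * m + 1) * (s k * ε))
        - cos ((2 * k - 1) * x) * sin ((2 * m + 1) * (s k * ε)))
      = cos ε - (-1) ^ m * cos ((2 * m + 1) * ε) * ((-1 : ℝ) ^ k * sin ((2 * k - 1) * x))
        - sin ((2 * m + 1) * ε) * (s k * cos ((2 * k - 1) * x))
        + if k = m + 1 then 2 - cos ε - cos ((2 * m + 1) * ε) else 0 := by
    intro k _
    rcases lt_trichotomy k (m + 1) with hk | rfl | hk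
    · rw [h_lt k (by omega), if_neg hk.ne, neg_one_mul, mul_neg, cos_neg, cos_neg, sin_neg]; ring
    · have hpow : (-1 : ℝ) ^ m * (-1) ^ (m + 1) = -1 := by
        rw [← pow_add]; exact Odd.neg_one_pow ⟨m, by ring⟩
      have harg : (2 * ((m + 1 : ℕ) : ℝ) - 1) * x = π / 2 := by
        push_cast; linear_combination hx
      rw [h_eq, if_pos rfl, harg]
      simp only [zero_mul, mul_zero, cos_zero, sin_zero, sin_pi_div_two, mul_one]
      linear_combination (cos ((2 * m + 1) * ε) - 1) * hpow
    · rw [h_gt k (by omega), if_neg hk.ne', one_mul]; ring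
  rw [Finset.sum_congr rfl hterm, Finset.sum_add_distrib, Finset.sum_sub_distrib,
    Finset.sum_sub_distrib, ← Finset.mul_sum, ← Finset.mul_sum, hsin, hcos, Finset.sum_ite_eq',
    if_pos (by rw [Finset.mem_Icc]; omega), Finset.sum_const, Nat.card_Icc, nsmul_eq_mul]
  push_cast
  ring

theorem witness_term (m k : ℕ) (x ε φ s : ℝ) (hx : (2 * m + 1) * x = π / 2)
    (hφ : 2 * φ = (-1) ^ m * (3 * (π / 2)) + x) :
    (-1) ^ k * (cos (m * (2 * k * x - (-1) ^ m * (-1) ^ k * s * ε) + φ) *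
        cos ((m + 1) * (2 * k * x + (-1) ^ m * (-1) ^ k * s * ε) - φ))
      = (cos (s * ε) - (-1) ^ m * (-1) ^ k * sin ((2 * k - 1) * x) * cos ((2 * m + 1) * (s * ε))
        - cos ((2 * k - 1) * x) * sin ((2 * m + 1) * (s * ε))) / 2 := by
  have hprod (a b : ℝ) : cos a * cos b = (cos (a + b) + cos (b - a)) / 2 := by
    rw [cos_add, cos_sub]; ring
  set a := m * (2 * k * x - (-1) ^ m * (-1) ^ k * s * ε) + φ
  set b := (m + 1) * (2 * k * x + (-1) ^ m * (-1) ^ k * s * ε) - φ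
  have h32s : sin (3 * (π / 2)) = -1 := by
    rw [show 3 * (π / 2) = π / 2 + π by ring, sin_add_pi, sin_pi_div_two]
  have h32c : cos (3 * (π / 2)) = 0 := by
    rw [show 3 * (π / 2) = π / 2 + π by ring, cos_add_pi, cos_pi_div_two, neg_zero]
  have hadd : a + b = (-1) ^ m * (-1) ^ k * (s * ε) + k * π := by
    simp only [a, b]; linear_combination 2 * k * hx
  have hsub : b - a = ((2 * k - 1) * x + (-1) ^ m * (-1) ^ k * ((2 * m + 1) * (s * ε)))
      - (-1) ^ m * (3 * (π / 2)) := by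
    simp only [a, b]; linear_combination -hφ
  rw [hprod, hadd, hsub, cos_add_nat_mul_pi]
  rcases neg_one_pow_eq_or ℝ m with h | h <;> rcases neg_one_pow_eq_or ℝ k with h' | h' <;>
    simp only [h, h', one_mul, neg_mul, mul_neg, neg_neg, cos_neg, sin_neg, cos_sub, cos_add,
      sin_add, h32s, h32c] <;> ring

theorem sign_mul_of_pos (a : ℝ) {b : ℝ} (hb : 0 < b) : Real.sign (a * b) = Real.sign a := by
  rcases lt_trichotomy a 0 with ha | rfl | ha
  · rw [Real.sign_of_neg ha, Real.sign_of_neg (mul_neg_of_neg_of_pos ha hb)]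
  · rw [zero_mul]
  · rw [Real.sign_of_pos ha, Real.sign_of_pos (mul_pos ha hb)]

theorem sign_mul_of_neg (a : ℝ) {b : ℝ} (hb : b < 0) : Real.sign (a * b) = -Real.sign a := by
  rw [← sign_mul_of_pos a (neg_pos.2 hb), mul_neg, Real.sign_neg, neg_neg]

/-- for odd n ≥ 5 and 0 ≤ ε ≤ π/(2n), the GHZ witness evaluated with the
misaligned settings N_k^{(j)} has expectation value
(1/(4n))[n − 2 − (n−1)cos ε + cos(nε) − sin(nε)/tan(π/(2n))] on the biseparable state
|ψₙ⟩ = |ψ₋⟩ ⊗ |ψ₊⟩ (the first n₋ = (n−1)/2 tensor factors carrying |ψ₋⟩).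
In the statement, a qubit index j ∈ {1,…,n} of the paper corresponds to `j : Fin n`
via j = (j : ℕ) + 1. -/
theorem stmt15 (n : ℕ) (hn : 5 ≤ n) (hodd : Odd n)
    (ε : ℝ) (hε₀ : 0 ≤ ε) (hε₁ : ε ≤ π / (2 * n))
    (ν : ℝ) (hν : ν = (-1 : ℝ) ^ ((n - 1) / 2))
    (g : ℕ → Fin n → ℝ)
    (hg : ∀ k j, g k j = ν * (-1 : ℝ) ^ k *
      Real.sign (((k : ℝ) - ((n : ℝ) + 1) / 2) * (((j : ℕ) + 1 : ℝ) - (n : ℝ) / 2)))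
    (N : ℕ → Fin n → Matrix (Fin 2) (Fin 2) ℂ)
    (hN : ∀ k j, N k j = cos ((k : ℝ) * π / n + g k j * ε) • σx
                       + sin ((k : ℝ) * π / n + g k j * ε) • σy)
    (ψ : (Fin n → Fin 2) → ℂ)
    (hψ : ψ = fun i => ((Real.sqrt 2 : ℂ))⁻¹ *
      ((∏ t ∈ Finset.univ.filter (fun t : Fin n => (t : ℕ) < (n - 1) / 2), (![1, 0] : Fin 2 → ℂ) (i t))
        + Complex.exp (-(ν : ℂ) * Complex.I * (((3 * (n : ℝ) + ν) * π / (4 * (n : ℝ)) : ℝ) : ℂ)) *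
          ∏ t ∈ Finset.univ.filter (fun t : Fin n => (t : ℕ) < (n - 1) / 2), (![0, 1] : Fin 2 → ℂ) (i t)) *
      ((Real.sqrt 2 : ℂ))⁻¹ *
      ((∏ t ∈ Finset.univ.filter (fun t : Fin n => ¬ (t : ℕ) < (n - 1) / 2), (![1, 0] : Fin 2 → ℂ) (i t))
        + Complex.exp ((ν : ℂ) * Complex.I * (((3 * (n : ℝ) + ν) * π / (4 * (n : ℝ)) : ℝ) : ℂ)) *
          ∏ t ∈ Finset.univ.filter (fun t : Fin n => ¬ (t : ℕ) < (n - 1) / 2), (![0, 1] : Fin 2 → ℂ) (i t)))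
    (W : Matrix (Fin n → Fin 2) (Fin n → Fin 2) ℂ)
    (hW : W = (1 / 2 : ℂ) • ((1 : Matrix (Fin n → Fin 2) (Fin n → Fin 2) ℂ)
        - ∑ l ∈ ({1, -1} : Finset ℝ),
            kronPow n ((1 / 2 : ℂ) • ((1 : Matrix (Fin 2) (Fin 2) ℂ) + l • σz))
        - (n : ℂ)⁻¹ • ∑ k ∈ Finset.Icc 1 n, ((-1 : ℂ)) ^ k • kronFam n (N k))) :
    star ψ ⬝ᵥ W.mulVec ψ
      = (((1 / (4 * (n : ℝ))) * ((n : ℝ) - 2 - ((n : ℝ) - 1) * cos ε + cos (n * ε)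
          - sin (n * ε) / Real.tan (π / (2 * n))) : ℝ) : ℂ) := by
  obtain ⟨m, rfl⟩ := hodd
  have hm : 0 < m := by omega
  have hm2 : (2 * m + 1 - 1) / 2 = m := by omega
  simp only [hm2] at hν hψ
  set S : Fin (2 * m + 1) → Prop := fun t => (t : ℕ) < m with hS
  set φ : ℝ := ν * ((3 * ((2 * m + 1 : ℕ) : ℝ) + ν) * π / (4 * ((2 * m + 1 : ℕ) : ℝ))) with hφ
  set x : ℝ := π / (2 * ((2 * m + 1 : ℕ) : ℝ)) with hxdef
  set c : Fin 2 → ℂ := fun a => (Real.sqrt 2 : ℂ)⁻¹ * ![1, Complex.exp ((-φ : ℝ) * Complex.I)] a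
    with hc
  set d : Fin 2 → ℂ := fun a => (Real.sqrt 2 : ℂ)⁻¹ * ![1, Complex.exp (φ * Complex.I)] a with hd
  have hn0 : ((2 * m + 1 : ℕ) : ℝ) ≠ 0 := by positivity
  have hx : (2 * m + 1) * x = π / 2 := by
    rw [hxdef]; push_cast; field_simp
  have hν2 : ν * ν = 1 := by rw [hν, ← mul_pow]; simp
  have hφ2 : 2 * φ = (-1) ^ m * (3 * (π / 2)) + x := by
    rw [hφ, hxdef, ← hν]; field_simp; linear_combination 4 * hν2
  have hcard : (Finset.univ.filter S).card = m := by
    rw [Fin.card_filter_val_lt]; omega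
  have hcard' : (Finset.univ.filter fun t => ¬ S t).card = m + 1 := by
    have := Finset.card_filter_add_card_filter_not (s := Finset.univ) S
    rw [hcard, Finset.card_univ, Fintype.card_fin] at this
    omega
  have he0 (y : Fin 2) : (![1, 0] : Fin 2 → ℂ) y = if y = 0 then 1 else 0 := by
    fin_cases y <;> rfl
  have he1 (y : Fin 2) : (![0, 1] : Fin 2 → ℂ) y = if y = 1 then 1 else 0 := by
    fin_cases y <;> rfl
  have hψ' : ∀ i, ψ i = (∑ a, c a * ∏ t with S t, if i t = a then 1 else 0) *
      (∑ b, d b * ∏ t with ¬ S t, if i t = b then 1 else 0) := by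
    intro i
    rw [hψ]
    simp only [he0, he1, Fin.sum_univ_two, hc, hd, hS, hφ, Matrix.cons_val_zero,
      Matrix.cons_val_one]
    push_cast
    ring_nf
  have expect (A : Fin (2 * m + 1) → Matrix (Fin 2) (Fin 2) ℂ) :=
    (star_dotProduct_kronFam_mulVec S A c d ψ hψ').trans
      (congrArg₂ (· * ·) (sum_sum_phase_qubit (-φ) _ rfl _) (sum_sum_phase_qubit φ _ rfl _))
  beta_reduce at expect
  have hone : star ψ ⬝ᵥ (1 : Matrix _ _ ℂ).mulVec ψ = 1 := by
    have h1 : (1 : Matrix (Fin (2 * m + 1) → Fin 2) (Fin (2 * m + 1) → Fin 2) ℂ)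
        = kronFam (2 * m + 1) fun _ => 1 := by
      ext i j
      simp [kronFam, Matrix.one_apply, Finset.prod_ite_zero, funext_iff]
    rw [h1, expect]
    simp only [Finset.prod_const, hcard, hcard']
    simp [zero_pow hm.ne']
  have hpop (l : ℝ) (hl : l = 1 ∨ l = -1) : star ψ ⬝ᵥ (kronPow (2 * m + 1)
      ((1 / 2 : ℂ) • ((1 : Matrix (Fin 2) (Fin 2) ℂ) + l • σz))).mulVec ψ = 1 / 4 := by
    have hpow (B : Matrix (Fin 2) (Fin 2) ℂ) :
        kronPow (2 * m + 1) B = kronFam (2 * m + 1) fun _ => B := rfl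
    rw [hpow, expect]
    simp only [Finset.prod_const, hcard, hcard']
    rcases hl with rfl | rfl <;> norm_num [σz, zero_pow hm.ne']
  have hk (k : ℕ) : (-1 : ℂ) ^ k * (star ψ ⬝ᵥ (kronFam (2 * m + 1) (N k)).mulVec ψ)
      = (((-1) ^ k * (cos (m * (2 * k * x - (-1) ^ m * (-1) ^ k * Real.sign (k - (m + 1)) * ε) + φ) *
        cos ((m + 1) * (2 * k * x + (-1) ^ m * (-1) ^ k * Real.sign (k - (m + 1)) * ε) - φ)) : ℝ) : ℂ) := by
    have hkx : (k : ℝ) * π / ((2 * m + 1 : ℕ) : ℝ) = 2 * k * x := by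
      rw [hxdef]; field_simp
    have hctr : (k : ℝ) - (((2 * m + 1 : ℕ) : ℝ) + 1) / 2 = k - (m + 1) := by push_cast; ring
    have hNl (t) (ht : S t) : N k t = !![0, Complex.exp
        (-((2 * k * x - (-1) ^ m * (-1) ^ k * Real.sign (k - (m + 1)) * ε : ℝ) * Complex.I));
        Complex.exp ((2 * k * x - (-1) ^ m * (-1) ^ k * Real.sign (k - (m + 1)) * ε : ℝ) * Complex.I), 0] := by
      have ht' : ((t : ℕ) : ℝ) + 1 ≤ m := by exact_mod_cast ht
      rw [hN, hg, hkx, hctr, sign_mul_of_neg _ (by push_cast; linarith), hν,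
        cos_smul_σx_add_sin_smul_σy]
      simp only [mul_neg, neg_mul, ← sub_eq_add_neg]
    have hNr (t) (ht : ¬ S t) : N k t = !![0, Complex.exp
        (-((2 * k * x + (-1) ^ m * (-1) ^ k * Real.sign (k - (m + 1)) * ε : ℝ) * Complex.I));
        Complex.exp ((2 * k * x + (-1) ^ m * (-1) ^ k * Real.sign (k - (m + 1)) * ε : ℝ) * Complex.I), 0] := by
      have ht' : (m : ℝ) ≤ ((t : ℕ) : ℝ) := by exact_mod_cast not_lt.1 ht
      rw [hN, hg, hkx, hctr, sign_mul_of_pos _ (by push_cast; linarith), hν,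
        cos_smul_σx_add_sin_smul_σy]
    have hl (a b : Fin 2) := Finset.prod_congr (rfl : Finset.univ.filter S = _)
      fun t ht => congrFun₂ (hNl t (Finset.mem_filter.1 ht).2) a b
    have hr (a b : Fin 2) := Finset.prod_congr (rfl : (Finset.univ.filter fun t => ¬ S t) = _)
      fun t ht => congrFun₂ (hNr t (Finset.mem_filter.1 ht).2) a b
    rw [expect]
    simp only [hl, hr, Finset.prod_const, hcard, hcard']
    simp only [Matrix.of_apply, Matrix.cons_val_zero, Matrix.cons_val_one, zero_pow hm.ne',
      zero_pow m.succ_ne_zero, zero_add, half_phase_sum _ _ _ _ rfl]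
    push_cast
    simp only [sub_neg_eq_add]
  have htotal := sum_witness_terms m hm (fun k => Real.sign (k - (m + 1))) x ε hx ?_ ?_ ?_
  · have hpos := hpop 1 (Or.inl rfl)
    have hneg := hpop (-1) (Or.inr rfl)
    rw [hW, Finset.sum_pair (by norm_num)]
    simp only [Matrix.smul_mulVec, Matrix.sub_mulVec, Matrix.add_mulVec, dotProduct_smul,
      dotProduct_sub, dotProduct_add, Matrix.sum_mulVec, dotProduct_sum, hone, hpos, hneg,
      smul_eq_mul, hk, witness_term m _ x ε φ _ hx hφ2]
    rw [← Complex.ofReal_sum, ← Finset.sum_div, htotal]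
    have hn0' : (2 * m + 1 : ℂ) ≠ 0 := by exact_mod_cast hn0
    push_cast
    field_simp
    ring
  · intro k hk
    have : (k : ℝ) ≤ m := by exact_mod_cast hk
    exact Real.sign_of_neg (by linarith)
  · simp
  · intro k hk
    have : (m : ℝ) + 2 ≤ k := by exact_mod_cast hk
    exact Real.sign_of_pos (by linarith)
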